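/- arXiv:1001.1901 — 5 statements merged into one kernel-verified Lean document; each statement's English description precedes it below -/
import Mathlib

section
/- Let ξ be a cost-sharing scheme satisfying Fence Monotonicity and let L ⊆ U ⊆ A. Then the harm relation on U is antisymmetric (there are no two distinct players i,j ∈ U such that i harms j and j harms i) and transitive (if i harms j and j harms k for distinct i,j,k ∈ U, then i harms k); hence it is a strict partial order on U. -/
open Finset

variable {n : ℕ}

/-- A cost-sharing scheme: nonnegative payments, and zero payment for non-serviced players. -/
def IsCostSharingScheme (ξ : Fin n → Finset (Fin n) → ℝ) : Prop :=
  (∀ i S, 0 ≤ ξ i S) ∧ (∀ i S, i ∉ S → ξ i S = 0)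

/-- The minimum payment ξ*(i,L,U) = min{ ξ(i,S) : L ⊆ S ⊆ U, i ∈ S }. -/
noncomputable def xiStar (ξ : Fin n → Finset (Fin n) → ℝ) (L U : Finset (Fin n)) (i : Fin n) : ℝ :=
  sInf {x : ℝ | ∃ S : Finset (Fin n), L ⊆ S ∧ S ⊆ U ∧ i ∈ S ∧ ξ i S = x}

/-- Fence Monotonicity at a pair L ⊆ U. -/
def FenceMonoAt (ξ : Fin n → Finset (Fin n) → ℝ) (L U : Finset (Fin n)) : Prop :=
  (∃ S : Finset (Fin n), L ⊆ S ∧ S ⊆ U ∧ ∀ i ∈ S, ξ i S = xiStar ξ L U i) ∧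
  (∀ i ∈ U \ L, ∃ S : Finset (Fin n), L ⊆ S ∧ S ⊆ U ∧ i ∈ S ∧
    ∀ j ∈ S \ L, ξ j S = xiStar ξ L U j) ∧
  (∀ C : Finset (Fin n), C ⊂ U → (∃ i ∈ C, ξ i C < xiStar ξ L U i) →
    ∃ T : Finset (Fin n), T.Nonempty ∧ T ⊆ L \ C ∧ ∀ j ∈ T, ξ j (C ∪ T) = xiStar ξ L U j)

/-- Fence Monotonicity: the three conditions hold at every pair L ⊆ U. -/
def FenceMonotone (ξ : Fin n → Finset (Fin n) → ℝ) : Prop :=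
  ∀ L U : Finset (Fin n), L ⊆ U → FenceMonoAt ξ L U

/-- Voluntary participation: a serviced player is never charged more than her bid. -/
def VP (ξ : Fin n → Finset (Fin n) → ℝ) (O : (Fin n → ℝ) → Finset (Fin n)) : Prop :=
  ∀ b : Fin n → ℝ, ∀ i ∈ O b, ξ i (O b) ≤ b i

/-- Consumer sovereignty: each player has a bid that guarantees service. -/
def CS (O : (Fin n → ℝ) → Finset (Fin n)) : Prop :=
  ∀ i : Fin n, ∃ bstar : ℝ, ∀ b : Fin n → ℝ, b i = bstar → i ∈ O b

/-- Utility of player `i` with true value `v i` at bid vector `b`. -/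
noncomputable def utility (ξ : Fin n → Finset (Fin n) → ℝ) (O : (Fin n → ℝ) → Finset (Fin n))
    (v b : Fin n → ℝ) (i : Fin n) : ℝ :=
  if i ∈ O b then v i - ξ i (O b) else 0

/-- Group-strategyproofness. -/
def GSP (ξ : Fin n → Finset (Fin n) → ℝ) (O : (Fin n → ℝ) → Finset (Fin n)) : Prop :=
  ∀ v v' : Fin n → ℝ,
    (∃ i : Fin n, v i ≠ v' i ∧ utility ξ O v v' i < utility ξ O v v i) ∨
    (∀ i : Fin n, utility ξ O v v' i = utility ξ O v v i)

/-- The pair (L,U) is stable at the bid vector b. -/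
def StablePair (ξ : Fin n → Finset (Fin n) → ℝ) (b : Fin n → ℝ) (L U : Finset (Fin n)) : Prop :=
  L ⊆ U ∧
  (∀ i ∈ L, xiStar ξ L U i < b i) ∧
  (∀ i ∈ U \ L, b i = xiStar ξ L U i) ∧
  (∀ R : Finset (Fin n), R ⊆ Uᶜ → R.Nonempty → ∃ i ∈ R, b i < xiStar ξ L (U ∪ R) i)

/-- Player i harms player j (at the pair L ⊆ U). -/
def Harms (ξ : Fin n → Finset (Fin n) → ℝ) (L U : Finset (Fin n)) (i j : Fin n) : Prop :=
  j ≠ i ∧ xiStar ξ L U j < xiStar ξ (insert i L) U j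

theorem xiStar_le {ξ : Fin n → Finset (Fin n) → ℝ} (hξ : IsCostSharingScheme ξ)
    {L U S : Finset (Fin n)} {i : Fin n} (hLS : L ⊆ S) (hSU : S ⊆ U) (hi : i ∈ S) :
    xiStar ξ L U i ≤ ξ i S := by
  refine csInf_le ⟨0, ?_⟩ ⟨S, hLS, hSU, hi, rfl⟩
  rintro x ⟨S, -, -, -, rfl⟩
  exact hξ.1 i S

theorem exists_eq_xiStar (ξ : Fin n → Finset (Fin n) → ℝ) {L U : Finset (Fin n)} {i : Fin n}
    (hLU : L ⊆ U) (hi : i ∈ U) :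
    ∃ S : Finset (Fin n), L ⊆ S ∧ S ⊆ U ∧ i ∈ S ∧ ξ i S = xiStar ξ L U i := by
  have hfin : {x : ℝ | ∃ S : Finset (Fin n), L ⊆ S ∧ S ⊆ U ∧ i ∈ S ∧ ξ i S = x}.Finite := by
    refine (Set.finite_range (ξ i)).subset ?_
    rintro x ⟨S, -, -, -, rfl⟩
    exact ⟨S, rfl⟩
  have hne : {x : ℝ | ∃ S : Finset (Fin n), L ⊆ S ∧ S ⊆ U ∧ i ∈ S ∧ ξ i S = x}.Nonempty :=
    ⟨ξ i U, U, hLU, Subset.rfl, hi, rfl⟩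
  exact hne.csInf_mem hfin

/-- Requiring a player to be serviced does not change her own minimum payment. -/
theorem xiStar_insert_self (ξ : Fin n → Finset (Fin n) → ℝ) (L U : Finset (Fin n)) (i : Fin n) :
    xiStar ξ (insert i L) U i = xiStar ξ L U i := by
  unfold xiStar
  congr 1
  ext x
  simp only [Set.mem_ofPred_eq, insert_subset_iff]
  exact exists_congr fun S => by tauto

/-- If `i` harms `j` and `j` harms `k`, then servicing `i` strictly increases the minimum payment
of `k`; the case `k = i` is allowed. -/
theorem xiStar_lt_xiStar_insert_of_harms {ξ : Fin n → Finset (Fin n) → ℝ}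
    (hξ : IsCostSharingScheme ξ) (hFM : FenceMonotone ξ) {L U : Finset (Fin n)} (hLU : L ⊆ U)
    {i j k : Fin n} (hi : i ∈ U) (hj : j ∈ U) (hk : k ∈ U)
    (hij : Harms ξ L U i j) (hjk : Harms ξ L U j k) :
    xiStar ξ L U k < xiStar ξ (insert i L) U k := by
  obtain ⟨S, hS, hSU, hkS, hS_eq⟩ := exists_eq_xiStar ξ (insert_subset hi hLU) hk
  have hLS : L ⊆ S := (subset_insert i L).trans hS
  rw [← hS_eq]
  by_cases hjS : j ∈ S
  · exact hjk.2.trans_le (xiStar_le hξ (insert_subset hjS hLS) hSU hkS)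
  refine lt_of_not_ge fun hle => ?_
  have hSs : S ⊂ U := (ssubset_iff_of_subset hSU).2 ⟨j, hj, hjS⟩
  obtain ⟨T, ⟨t, ht⟩, hTs, hT⟩ :=
    (hFM (insert j L) U (insert_subset hj hLU)).2.2 S hSs ⟨k, hkS, hle.trans_lt hjk.2⟩
  have eq_j : ∀ x ∈ T, x = j := fun x hx => by
    have := hTs hx
    rw [mem_sdiff, mem_insert] at this
    exact this.1.resolve_right fun h => this.2 (hLS h)
  obtain rfl := eq_j t ht
  have hSTU : S ∪ T ⊆ U := union_subset hSU fun x hx => eq_j x hx ▸ hj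
  have hpay := xiStar_le hξ (hS.trans subset_union_left) hSTU (mem_union_right S ht)
  rw [hT t ht, xiStar_insert_self] at hpay
  exact hij.2.not_ge hpay

/-- Under Fence Monotonicity, the harm relation on U is antisymmetric and
transitive, hence a strict partial order on U. -/
theorem stmt3 (ξ : Fin n → Finset (Fin n) → ℝ) (hξ : IsCostSharingScheme ξ)
    (hFM : FenceMonotone ξ) (L U : Finset (Fin n)) (hLU : L ⊆ U) :
    (∀ i ∈ U, ∀ j ∈ U, i ≠ j → ¬(Harms ξ L U i j ∧ Harms ξ L U j i)) ∧
    (∀ i ∈ U, ∀ j ∈ U, ∀ k ∈ U, i ≠ j → j ≠ k → i ≠ k →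
      Harms ξ L U i j → Harms ξ L U j k → Harms ξ L U i k) := by
  refine ⟨fun i hi j hj _ h => ?_, fun i hi j hj k hk _ _ hik hij hjk => ?_⟩
  · have := xiStar_lt_xiStar_insert_of_harms hξ hFM hLU hi hj hi h.1 h.2
    rw [xiStar_insert_self] at this
    exact this.false
  · exact ⟨hik.symm, xiStar_lt_xiStar_insert_of_harms hξ hFM hLU hi hj hk hij hjk⟩
end

section
/- Let O be a mechanism based on a cost-sharing scheme ξ satisfying VP, CS and GSP. Let L′ ⊆ U′ ⊆ A and j ∈ U′∖L′, and suppose there exists a set S_j with L′ ⊆ S_j ⊆ U′, j ∈ S_j, such that ξ(i,S_j) = ξ*(i,L′,U′) for all i ∈ S_j∖L′. Then at any bid vector b with b_i = b_i* for all i ∈ L′, b_j > ξ*(j,L′,U′), b_i = ξ*(i,L′,U′) for all i ∈ U′∖(L′∪{j}), and b_i = −1 for all i ∉ U′, it holds that j ∈ O(b) and ξ(j,O(b)) = ξ*(j,L′,U′). -/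
open Finset

variable {n : ℕ}

/-- Under voluntary participation, a player with a negative bid is not serviced. -/
theorem VP.notMem_of_neg {ξ : Fin n → Finset (Fin n) → ℝ} (hξ : IsCostSharingScheme ξ)
    {O : (Fin n → ℝ) → Finset (Fin n)} (hVP : VP ξ O) {b : Fin n → ℝ} {i : Fin n}
    (hi : b i < 0) : i ∉ O b := fun h =>
  absurd ((hξ.1 i (O b)).trans (hVP b i h)) (not_le.mpr hi)

/-- If condition (b) of Fence Monotonicity holds for j at (L',U'), then at any
bid vector where players in L' bid their guaranteeing values, j bids above her minimum
payment, players in U'∖(L'∪{j}) bid their minimum payments and the rest bid −1,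
player j is serviced and charged ξ*(j,L',U'). -/
theorem stmt6 (ξ : Fin n → Finset (Fin n) → ℝ) (hξ : IsCostSharingScheme ξ)
    (O : (Fin n → ℝ) → Finset (Fin n)) (hVP : VP ξ O) (hGSP : GSP ξ O)
    (bstar : Fin n → ℝ)
    (hCS : ∀ i : Fin n, ∀ b : Fin n → ℝ, b i = bstar i → i ∈ O b)
    (L' U' : Finset (Fin n)) (hLU : L' ⊆ U') (j : Fin n) (hj : j ∈ U' \ L')
    (hSj : ∃ Sj : Finset (Fin n), L' ⊆ Sj ∧ Sj ⊆ U' ∧ j ∈ Sj ∧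
      ∀ i ∈ Sj \ L', ξ i Sj = xiStar ξ L' U' i)
    (b : Fin n → ℝ)
    (hbL : ∀ i ∈ L', b i = bstar i)
    (hbj : xiStar ξ L' U' j < b j)
    (hbU : ∀ i ∈ U' \ (insert j L'), b i = xiStar ξ L' U' i)
    (hbout : ∀ i : Fin n, i ∉ U' → b i = -1) :
    j ∈ O b ∧ ξ j (O b) = xiStar ξ L' U' j := by
  obtain ⟨S, hLS, hSU, hjS, hS⟩ := hSj
  obtain ⟨-, hjL⟩ := mem_sdiff.mp hj
  set c : Fin n → ℝ := fun i => if i ∈ S then bstar i else -1 with hc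
  have hOc : O c = S := by
    ext i
    constructor
    · intro h
      by_contra hi
      exact hVP.notMem_of_neg hξ (by simp [hc, hi]) h
    · intro hi
      exact hCS i c (by simp [hc, hi])
  have hLO : L' ⊆ O b := fun i hi => hCS i b (hbL i hi)
  have hOU : O b ⊆ U' := fun i hi => by
    by_contra h
    exact hVP.notMem_of_neg hξ (by rw [hbout i h]; norm_num) hi
  have hcj : utility ξ O b c j = b j - xiStar ξ L' U' j := by
    rw [utility, hOc, if_pos hjS, hS j (mem_sdiff.mpr ⟨hjS, hjL⟩)]
  have hbj_le : utility ξ O b b j ≤ b j - xiStar ξ L' U' j := by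
    rw [utility]
    split_ifs with h
    · linarith [xiStar_le hξ hLO hOU h]
    · linarith
  have hzero : ∀ i ∈ U' \ insert j L', utility ξ O b b i = 0 ∧ utility ξ O b c i = 0 := by
    intro i hi
    have hbi := hbU i hi
    simp only [mem_sdiff, mem_insert, not_or] at hi
    refine ⟨?_, ?_⟩
    · rw [utility]
      split_ifs with h
      · linarith [xiStar_le hξ hLO hOU h, hVP b i h]
      · rfl
    · rw [utility, hOc]
      split_ifs with h
      · rw [hS i (mem_sdiff.mpr ⟨h, hi.2.2⟩), hbi, sub_self]
      · rfl
  have heq : utility ξ O b b j = b j - xiStar ξ L' U' j := by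
    rcases hGSP b c with ⟨i, hne, hlt⟩ | h
    · by_cases hij : i = j
      · subst hij
        linarith
      · exfalso
        have hiL : i ∉ L' := fun h => hne (by simp [hc, hLS h, hbL i h])
        have hiU : i ∈ U' := by
          by_contra h
          have hiS : i ∉ S := fun hs => h (hSU hs)
          exact hne (by simp [hc, hiS, hbout i h])
        obtain ⟨h1, h2⟩ := hzero i (by simp [hiU, hij, hiL])
        linarith
    · rw [← h j, hcj]
  rw [utility] at heq
  split_ifs at heq with h
  · exact ⟨h, by linarith⟩
  · linarith
end

section
/- Let ξ be a cost-sharing scheme. For every bid vector b and every set L ⊆ A, there exists a unique maximal set U with L ⊆ U ⊆ A such that b_i ≥ ξ*(i,L,U) for all i ∈ U∖L; that is, every set U′ with L ⊆ U′ ⊆ A satisfying b_i ≥ ξ*(i,L,U′) for all i ∈ U′∖L is a subset of U. Moreover, this maximal U satisfies: for every nonempty R ⊆ A∖U there is some i ∈ R with b_i < ξ*(i,L,U∪R). -/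
open Finset

variable {n : ℕ}

/-- Enlarging the upper set can only lower the minimum payment. -/
lemma xiStar_anti {ξ : Fin n → Finset (Fin n) → ℝ} (hξ : ∀ i S, 0 ≤ ξ i S)
    {L U V : Finset (Fin n)} (hL : L ⊆ U) (hUV : U ⊆ V) {i : Fin n} (hi : i ∈ U) :
    xiStar ξ L V i ≤ xiStar ξ L U i := by
  refine csInf_le_csInf ⟨0, ?_⟩ ⟨ξ i U, U, hL, Subset.rfl, hi, rfl⟩ ?_
  · rintro x ⟨S, -, -, -, rfl⟩
    exact hξ i S
  · rintro x ⟨S, hLS, hSU, hiS, rfl⟩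
    exact ⟨S, hLS, hSU.trans hUV, hiS, rfl⟩

/-- For every bid vector b and every L there exists a unique maximal set U
containing L with b_i ≥ ξ*(i,L,U) for all i ∈ U∖L; moreover this U satisfies condition (3)
of stability. -/
theorem stmt10 (ξ : Fin n → Finset (Fin n) → ℝ) (hξ : IsCostSharingScheme ξ)
    (b : Fin n → ℝ) (L : Finset (Fin n)) :
    ∃! U : Finset (Fin n), L ⊆ U ∧ (∀ i ∈ U \ L, xiStar ξ L U i ≤ b i) ∧
      (∀ U' : Finset (Fin n), L ⊆ U' → (∀ i ∈ U' \ L, xiStar ξ L U' i ≤ b i) → U' ⊆ U) ∧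
      (∀ R : Finset (Fin n), R ⊆ Uᶜ → R.Nonempty →
        ∃ i ∈ R, b i < xiStar ξ L (U ∪ R) i) := by
  classical
  let feasible : Finset (Fin n) → Prop :=
    fun U => L ⊆ U ∧ ∀ i ∈ U \ L, xiStar ξ L U i ≤ b i
  let M : Finset (Fin n) := (univ.filter feasible).biUnion id
  have le_M : ∀ U, feasible U → U ⊆ M := fun U hU =>
    subset_biUnion_of_mem id (mem_filter.2 ⟨mem_univ U, hU⟩)
  have hLM : L ⊆ M := le_M L ⟨Subset.rfl, by simp⟩
  have hM : ∀ i ∈ M \ L, xiStar ξ L M i ≤ b i := by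
    intro i hi
    obtain ⟨hiM, hiL⟩ := mem_sdiff.1 hi
    obtain ⟨U, hU, hiU⟩ := mem_biUnion.1 hiM
    have hU' : feasible U := (mem_filter.1 hU).2
    exact (xiStar_anti hξ.1 hU'.1 (le_M U hU') hiU).trans
      (hU'.2 i (mem_sdiff.2 ⟨hiU, hiL⟩))
  refine ⟨M, ⟨hLM, hM, fun U hLU hU => le_M U ⟨hLU, hU⟩, ?_⟩, ?_⟩
  · intro R hR hne
    by_contra! hcon
    have hMR : feasible (M ∪ R) := by
      refine ⟨hLM.trans subset_union_left, fun i hi => ?_⟩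
      obtain ⟨hiMR, hiL⟩ := mem_sdiff.1 hi
      rcases mem_union.1 hiMR with hiM | hiR
      · exact (xiStar_anti hξ.1 hLM subset_union_left hiM).trans
          (hM i (mem_sdiff.2 ⟨hiM, hiL⟩))
      · exact hcon i hiR
    obtain ⟨r, hr⟩ := hne
    exact mem_compl.1 (hR hr) (le_M _ hMR (mem_union_right M hr))
  · rintro V ⟨hLV, hV, hmax, -⟩
    exact (le_M V ⟨hLV, hV⟩).antisymm (hmax M hLM hM)
end

section
/- Let ξ be a cost-sharing scheme satisfying Fence Monotonicity, suppose the pair (L,U) is stable at the bid vector b, and let S ⊆ A be a set such that b_i ≥ ξ(i,S) for all i ∈ S. If either (a) S is not a subset of U, or (b) S ⊆ U and ξ(i,S) < ξ*(i,L,U) for some i ∈ S, then there exists a nonempty set T ⊆ L∖S such that ξ(j,S∪T) < b_j for all j ∈ T. -/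
open Finset

variable {n : ℕ}

theorem bddBelow_xiStar_set {ξ : Fin n → Finset (Fin n) → ℝ} (hξ : IsCostSharingScheme ξ)
    (L U : Finset (Fin n)) (i : Fin n) :
    BddBelow {x : ℝ | ∃ S : Finset (Fin n), L ⊆ S ∧ S ⊆ U ∧ i ∈ S ∧ ξ i S = x} :=
  ⟨0, by rintro _ ⟨S, -, -, -, rfl⟩; exact hξ.1 i S⟩

theorem xiStar_anti_right {ξ : Fin n → Finset (Fin n) → ℝ} (hξ : IsCostSharingScheme ξ)
    {L U V : Finset (Fin n)} {i : Fin n} (hLU : L ⊆ U) (hUV : U ⊆ V) (hi : i ∈ U) :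
    xiStar ξ L V i ≤ xiStar ξ L U i := by
  refine csInf_le_csInf (bddBelow_xiStar_set hξ L V i) ⟨_, U, hLU, Subset.rfl, hi, rfl⟩ ?_
  rintro x ⟨S, hLS, hSU, hiS, hx⟩
  exact ⟨S, hLS, hSU.trans hUV, hiS, hx⟩

/-- Underpayment relative to a pair `(L, V)` with `U ⊆ V` already yields the conclusion when every
member of `L` bids above her minimum payment at `(L, U)`. -/
theorem exists_subset_sdiff_lt_bid {ξ : Fin n → Finset (Fin n) → ℝ} (hξ : IsCostSharingScheme ξ)
    (hFM : FenceMonotone ξ) {b : Fin n → ℝ} {L U V S : Finset (Fin n)} (hLU : L ⊆ U)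
    (hb : ∀ i ∈ L, xiStar ξ L U i < b i) (hUV : U ⊆ V) (hSV : S ⊆ V)
    (hlt : ∃ i ∈ S, ξ i S < xiStar ξ L V i) :
    ∃ T : Finset (Fin n), T.Nonempty ∧ T ⊆ L \ S ∧ ∀ j ∈ T, ξ j (S ∪ T) < b j := by
  have hSV' : S ⊂ V := by
    refine hSV.ssubset_of_ne ?_
    rintro rfl
    obtain ⟨i, hi, h⟩ := hlt
    exact h.not_ge (xiStar_le hξ (hLU.trans hUV) Subset.rfl hi)
  obtain ⟨T, hT, hTL, hpay⟩ := (hFM L V (hLU.trans hUV)).2.2 S hSV' hlt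
  refine ⟨T, hT, hTL, fun j hj => ?_⟩
  have hjL : j ∈ L := (mem_sdiff.mp (hTL hj)).1
  rw [hpay j hj]
  exact (xiStar_anti_right hξ hLU hUV (hLU hjL)).trans_lt (hb j hjL)

/-- If (L,U) is stable at b, S is a set whose members can all pay their
charge in S, and either S ⊄ U or some member of S pays below her minimum payment at (L,U),
then some nonempty T ⊆ L∖S satisfies ξ(j,S∪T) < b_j for all j ∈ T. -/
theorem stmt11 (ξ : Fin n → Finset (Fin n) → ℝ) (hξ : IsCostSharingScheme ξ)
    (hFM : FenceMonotone ξ) (b : Fin n → ℝ) (L U : Finset (Fin n))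
    (hstable : StablePair ξ b L U) (S : Finset (Fin n))
    (hS : ∀ i ∈ S, ξ i S ≤ b i)
    (hcase : (¬ S ⊆ U) ∨ (S ⊆ U ∧ ∃ i ∈ S, ξ i S < xiStar ξ L U i)) :
    ∃ T : Finset (Fin n), T.Nonempty ∧ T ⊆ L \ S ∧ ∀ j ∈ T, ξ j (S ∪ T) < b j := by
  obtain ⟨hLU, hb, -, hmax⟩ := hstable
  rcases hcase with hSU | ⟨hSU, hlt⟩
  · obtain ⟨i, hi, hbi⟩ := hmax (S \ U)
      (fun i hi => mem_compl.mpr (mem_sdiff.mp hi).2) (sdiff_nonempty.mpr hSU)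
    have hiS : i ∈ S := (mem_sdiff.mp hi).1
    rw [union_sdiff_self_eq_union] at hbi
    exact exists_subset_sdiff_lt_bid hξ hFM hLU hb subset_union_left subset_union_right
      ⟨i, hiS, (hS i hiS).trans_lt hbi⟩
  · exact exists_subset_sdiff_lt_bid hξ hFM hLU hb Subset.rfl hSU hlt
end

section
/- Let ξ be a cost-sharing scheme satisfying Fence Monotonicity. For every bid vector b there is at most one stable pair: if (L1,U1) and (L2,U2) are both stable at b, then L1 = L2 and U1 = U2. -/
open Finset

variable {n : ℕ}

/-- The minimum payment is the greatest lower bound of the payments it ranges over. -/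
theorem le_xiStar {ξ : Fin n → Finset (Fin n) → ℝ} {L U : Finset (Fin n)} {i : Fin n}
    (hLU : L ⊆ U) (hi : i ∈ U) {a : ℝ}
    (h : ∀ S, L ⊆ S → S ⊆ U → i ∈ S → a ≤ ξ i S) : a ≤ xiStar ξ L U i := by
  refine le_csInf ⟨ξ i U, U, hLU, Subset.rfl, hi, rfl⟩ ?_
  rintro x ⟨S, hLS, hSU, hiS, rfl⟩
  exact h S hLS hSU hiS

/-- In a stable pair, nobody in the upper set bids below her minimum payment. -/
theorem StablePair.xiStar_le_bid {ξ : Fin n → Finset (Fin n) → ℝ} {b : Fin n → ℝ}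
    {L U : Finset (Fin n)} (h : StablePair ξ b L U) {i : Fin n} (hi : i ∈ U) :
    xiStar ξ L U i ≤ b i := by
  by_cases hiL : i ∈ L
  · exact (h.2.1 i hiL).le
  · exact (h.2.2.1 i (mem_sdiff.2 ⟨hi, hiL⟩)).ge

/-- In a stable pair, the lower set consists of the players bidding above their minimum payment. -/
theorem StablePair.mem_lower_iff {ξ : Fin n → Finset (Fin n) → ℝ} {b : Fin n → ℝ}
    {L U : Finset (Fin n)} (h : StablePair ξ b L U) {i : Fin n} :
    i ∈ L ↔ i ∈ U ∧ xiStar ξ L U i < b i := by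
  refine ⟨fun hi => ⟨h.1 hi, h.2.1 i hi⟩, fun ⟨hi, hlt⟩ => ?_⟩
  by_contra hiL
  exact hlt.ne' (h.2.2.1 i (mem_sdiff.2 ⟨hi, hiL⟩))

/-- If `(L, U)` is stable, a set of new players all of whom pay less than their bids cannot join
a set between `L` and `U`. -/
theorem StablePair.exists_bid_le {ξ : Fin n → Finset (Fin n) → ℝ} (hξ : IsCostSharingScheme ξ)
    {b : Fin n → ℝ} {L U C T : Finset (Fin n)} (h : StablePair ξ b L U)
    (hLC : L ⊆ C) (hCU : C ⊆ U) (hT : T.Nonempty) (hTC : Disjoint T C) :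
    ∃ j ∈ T, b j ≤ ξ j (C ∪ T) := by
  by_cases hTU : T ⊆ U
  · obtain ⟨j, hj⟩ := hT
    refine ⟨j, hj, ?_⟩
    have hjL : j ∉ L := fun hjL => disjoint_left.1 hTC hj (hLC hjL)
    rw [h.2.2.1 j (mem_sdiff.2 ⟨hTU hj, hjL⟩)]
    exact xiStar_le hξ (hLC.trans subset_union_left) (union_subset hCU hTU)
      (mem_union_right _ hj)
  · obtain ⟨j, hj, hlt⟩ := h.2.2.2 (T \ U)
      (fun x hx => mem_compl.2 (mem_sdiff.1 hx).2) (sdiff_nonempty.2 hTU)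
    have hjT : j ∈ T := (mem_sdiff.1 hj).1
    refine ⟨j, hjT, hlt.le.trans (xiStar_le hξ (hLC.trans subset_union_left) ?_
      (mem_union_right _ hjT))⟩
    rw [union_sdiff_self_eq_union]
    exact union_subset_union_left hCU

/-- Minimum payments at a stable pair dominate those at any other stable pair with the upper set
extended to the union. -/
theorem StablePair.xiStar_union_le {ξ : Fin n → Finset (Fin n) → ℝ} (hξ : IsCostSharingScheme ξ)
    (hFM : FenceMonotone ξ) {b : Fin n → ℝ} {L₁ U₁ L₂ U₂ : Finset (Fin n)}
    (h₁ : StablePair ξ b L₁ U₁) (h₂ : StablePair ξ b L₂ U₂) {i : Fin n} (hi : i ∈ U₂) :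
    xiStar ξ L₁ (U₁ ∪ U₂) i ≤ xiStar ξ L₂ U₂ i := by
  have hL : L₁ ⊆ U₁ ∪ U₂ := h₁.1.trans subset_union_left
  refine le_xiStar h₂.1 hi fun C hLC hCU hiC => ?_
  have hC : C ⊆ U₁ ∪ U₂ := hCU.trans subset_union_right
  by_contra! hlt
  by_cases hCL : L₁ ⊆ C
  · exact hlt.not_ge (xiStar_le hξ hCL hC hiC)
  have hCne : C ≠ U₁ ∪ U₂ := fun h => hCL (h ▸ hL)
  obtain ⟨T, hT, hTL, hpay⟩ := (hFM _ _ hL).2.2 C (hC.ssubset_of_ne hCne) ⟨i, hiC, hlt⟩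
  obtain ⟨j, hj, hle⟩ := h₂.exists_bid_le hξ hLC hCU hT (disjoint_sdiff_self_left.mono_left hTL)
  have hjL : j ∈ L₁ := (mem_sdiff.1 (hTL hj)).1
  rw [hpay j hj] at hle
  exact (hle.trans (xiStar_anti_right hξ h₁.1 subset_union_left (h₁.1 hjL))).not_gt (h₁.2.1 j hjL)

/-- The upper set of a stable pair contains the upper set of any other stable pair. -/
theorem StablePair.upper_subset {ξ : Fin n → Finset (Fin n) → ℝ} (hξ : IsCostSharingScheme ξ)
    (hFM : FenceMonotone ξ) {b : Fin n → ℝ} {L₁ U₁ L₂ U₂ : Finset (Fin n)}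
    (h₁ : StablePair ξ b L₁ U₁) (h₂ : StablePair ξ b L₂ U₂) : U₂ ⊆ U₁ := by
  by_contra hsub
  obtain ⟨i, hi, hlt⟩ := h₁.2.2.2 (U₂ \ U₁)
    (fun x hx => mem_compl.2 (mem_sdiff.1 hx).2) (sdiff_nonempty.2 hsub)
  have hiU : i ∈ U₂ := (mem_sdiff.1 hi).1
  rw [union_sdiff_self_eq_union] at hlt
  exact hlt.not_ge ((h₁.xiStar_union_le hξ hFM h₂ hiU).trans (h₂.xiStar_le_bid hiU))

/-- Under Fence Monotonicity, there is at most one stable pair at every bid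
vector. -/
theorem stmt13 (ξ : Fin n → Finset (Fin n) → ℝ) (hξ : IsCostSharingScheme ξ)
    (hFM : FenceMonotone ξ) (b : Fin n → ℝ) (L1 U1 L2 U2 : Finset (Fin n))
    (h1 : StablePair ξ b L1 U1) (h2 : StablePair ξ b L2 U2) :
    L1 = L2 ∧ U1 = U2 := by
  obtain rfl : U1 = U2 := (h2.upper_subset hξ hFM h1).antisymm (h1.upper_subset hξ hFM h2)
  refine ⟨?_, rfl⟩
  ext i
  rw [h1.mem_lower_iff, h2.mem_lower_iff]
  refine and_congr_right fun hi => ?_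
  have h12 := h1.xiStar_union_le hξ hFM h2 hi
  have h21 := h2.xiStar_union_le hξ hFM h1 hi
  rw [union_self] at h12 h21
  rw [h12.antisymm h21]
end
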